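/- arXiv:1704.00882 — 2 statements merged into one kernel-verified Lean document; each statement's English description precedes it below -/
import Mathlib

section
/- Let n > 1 and let τ be any bijection on the set of partitions of n that nearly preserves the rank–crank distribution. Then ospt(n) equals the number of partitions λ of n such that crank(λ) − rank(τ(λ)) = 1. -/
open scoped BigOperators

namespace RankCrank

/-- The `i`-th largest part of a partition (1-indexed); `0` if `i` exceeds
the number of parts. -/
def part {n : ℕ} (l : n.Partition) (i : ℕ) : ℕ :=
  ((l.parts.sort (· ≤ ·)).reverse).getD (i - 1) 0

/-- The rank of a partition: largest part minus number of parts. -/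
def rank {n : ℕ} (l : n.Partition) : ℤ :=
  (part l 1 : ℤ) - l.parts.card

/-- The crank of a partition: the largest part if there are no parts equal to 1,
otherwise the number of parts larger than the number of 1's minus the number of 1's. -/
def crank {n : ℕ} (l : n.Partition) : ℤ :=
  if l.parts.count 1 = 0 then (part l 1 : ℤ)
  else ((l.parts.filter (fun x => l.parts.count 1 < x)).card : ℤ) - l.parts.count 1

/-- `N m n` is the number of partitions of `n` with rank `m`. -/
noncomputable def N (m : ℤ) (n : ℕ) : ℕ :=
  Nat.card {l : n.Partition // rank l = m}

/-- `M m n` is the number of partitions of `n` with crank `m` for `n ≠ 1`, with the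
usual convention for `n = 1`. -/
noncomputable def M (m : ℤ) (n : ℕ) : ℤ :=
  if n = 1 then (if m = 0 then -1 else if m = 1 ∨ m = -1 then 1 else 0)
  else (Nat.card {l : n.Partition // crank l = m} : ℤ)

/-- `Nle m n = N(≤ m, n) = ∑_{r ≤ m} N(r,n)`; since `N(r,n) = 0` for `r < -n`,
the sum may be taken over `-n ≤ r ≤ m`. -/
noncomputable def Nle (m : ℤ) (n : ℕ) : ℤ :=
  ∑ r ∈ Finset.Icc (-(n : ℤ)) m, (N r n : ℤ)

/-- `Mle m n = M(≤ m, n) = ∑_{r ≤ m} M(r,n)`; since `M(r,n) = 0` for `r < -n`,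
the sum may be taken over `-n ≤ r ≤ m`. -/
noncomputable def Mle (m : ℤ) (n : ℕ) : ℤ :=
  ∑ r ∈ Finset.Icc (-(n : ℤ)) m, M r n

/-- The number of partitions of `n`. -/
noncomputable def p (n : ℕ) : ℕ := Nat.card n.Partition

/-- `ospt n = ∑_{m ≥ 0} m M(m,n) - ∑_{m ≥ 0} m N(m,n)`; since ranks and cranks of
partitions of `n` are at most `n`, the sums may be taken over `0 ≤ m ≤ n`. -/
noncomputable def ospt (n : ℕ) : ℤ :=
  (∑ m ∈ Finset.Icc (0 : ℤ) (n : ℤ), m * M m n) -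
    (∑ m ∈ Finset.Icc (0 : ℤ) (n : ℤ), m * (N m n : ℤ))

/-- The rank-set of a partition `λ`:  `{j - λ_{j+1} : 0 ≤ j ≤ ℓ-1} ∪ {j : j ≥ ℓ}`
(note `part l (j+1) = 0` for `j ≥ ℓ`). -/
def rankSet {n : ℕ} (l : n.Partition) : Set ℤ :=
  {x | ∃ j : ℕ, x = (j : ℤ) - (part l (j + 1) : ℤ)}

/-- `q m n` is the number of partitions of `n` whose rank-set contains `m`. -/
noncomputable def q (m : ℤ) (n : ℕ) : ℕ :=
  Nat.card {l : n.Partition // m ∈ rankSet l}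

/-- `prank m n` is the number of partitions of `n` with rank at least `m`. -/
noncomputable def prank (m : ℤ) (n : ℕ) : ℕ :=
  Nat.card {l : n.Partition // m ≤ rank l}

/-- `jm m l` is the number of columns of the `m`-Durfee rectangle of `l`: the largest
`j ≥ 0` with `λ_{m+j} ≥ j`. -/
noncomputable def jm {n : ℕ} (m : ℕ) (l : n.Partition) : ℕ :=
  sSup {j : ℕ | j ≤ part l (m + j)}

/-- The total number of smallest parts in all partitions of `n`. -/
def spt (n : ℕ) : ℕ :=
  ∑ l : n.Partition, l.parts.count ((l.parts.sort (· ≤ ·)).headD 0)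

/-- A bijection `τ` on partitions of `n` nearly preserves the rank–crank
distribution if `crank λ - rank (τ λ)` is `0` when `crank λ = 0`, is `0` or `1`
when `crank λ > 0`, and is `0` or `-1` when `crank λ < 0`. -/
def NearlyPreserves {n : ℕ} (τ : n.Partition ≃ n.Partition) : Prop :=
  ∀ l : n.Partition,
    (crank l = 0 → crank l - rank (τ l) = 0) ∧
    (0 < crank l → crank l - rank (τ l) = 0 ∨ crank l - rank (τ l) = 1) ∧
    (crank l < 0 → crank l - rank (τ l) = 0 ∨ crank l - rank (τ l) = -1)

end RankCrank

namespace RankCrank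

theorem part_le {n : ℕ} (l : n.Partition) (i : ℕ) : part l i ≤ n := by
  unfold part
  rw [List.getD_eq_getElem?_getD]
  rcases h : (l.parts.sort (· ≤ ·)).reverse[i - 1]? with _ | a
  · simp
  · have ha : a ∈ l.parts := by simpa using List.mem_of_getElem? h
    simpa [l.parts_sum] using Multiset.le_sum_of_mem ha

theorem card_parts_le {n : ℕ} (l : n.Partition) : l.parts.card ≤ n := by
  have h := Multiset.card_nsmul_le_sum (s := l.parts) (a := 1) fun x hx => l.parts_pos hx
  simpa [l.parts_sum] using h

theorem rank_le {n : ℕ} (l : n.Partition) : rank l ≤ n := by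
  have := part_le l 1
  unfold rank
  omega

theorem crank_le {n : ℕ} (l : n.Partition) : crank l ≤ n := by
  have h₁ := part_le l 1
  have h₂ := card_parts_le l
  have h₃ := Multiset.card_le_card
    (Multiset.filter_le (fun x => l.parts.count 1 < x) l.parts)
  unfold crank
  split_ifs <;> omega

/-- The first moment over the nonnegative values of a bounded integer statistic is the sum of
its positive parts. -/
theorem sum_mul_card_fiber {α : Type*} [Fintype α] (f : α → ℤ) (b : ℤ) (hf : ∀ a, f a ≤ b) :
    ∑ m ∈ Finset.Icc (0 : ℤ) b, m * (Nat.card {a // f a = m} : ℤ) = ∑ a, max (f a) 0 := by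
  classical
  have hcard (m : ℤ) : m * (Nat.card {a // f a = m} : ℤ) = ∑ a, if f a = m then m else 0 := by
    rw [Nat.card_eq_fintype_card, Fintype.card_subtype, Finset.sum_ite]
    simp [mul_comm]
  simp_rw [hcard]
  rw [Finset.sum_comm]
  refine Finset.sum_congr rfl fun a _ => ?_
  have := hf a
  rw [Finset.sum_ite_eq]
  split_ifs with h <;> rw [Finset.mem_Icc] at h <;> omega

end RankCrank

open RankCrank in
/-- For `n > 1` and any bijection `τ` on partitions of `n` nearly preserving the
rank–crank distribution, `ospt n` equals the number of partitions `λ` of `n` with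
`crank λ - rank (τ λ) = 1`. -/
theorem ospt_eq_card (n : ℕ) (hn : 1 < n) (τ : n.Partition ≃ n.Partition)
    (hτ : NearlyPreserves τ) :
    ospt n = (Nat.card {l : n.Partition // crank l - rank (τ l) = 1} : ℤ) := by
  have hM : ∑ m ∈ Finset.Icc (0 : ℤ) (n : ℤ), m * M m n =
      ∑ l : n.Partition, max (crank l) 0 := by
    rw [← sum_mul_card_fiber crank n crank_le]
    simp only [M, if_neg hn.ne']
  have hN : ∑ m ∈ Finset.Icc (0 : ℤ) (n : ℤ), m * (N m n : ℤ) =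
      ∑ l : n.Partition, max (rank (τ l)) 0 := by
    rw [Equiv.sum_comp τ fun l => max (rank l) 0]
    exact sum_mul_card_fiber rank n rank_le
  rw [ospt, hM, hN, ← Finset.sum_sub_distrib, Nat.card_eq_fintype_card, Fintype.card_subtype,
    Finset.card_filter, Nat.cast_sum]
  refine Finset.sum_congr rfl fun l _ => ?_
  have := hτ l
  split_ifs <;> omega
end

section
/- For every integer n > 1, ospt(n) > 0. -/
open scoped BigOperators

namespace RankCrank

/-- `f` is the sequence of parts, in weakly decreasing order and padded with zeros, of a
partition of `n`. -/
def IsProfile (n : ℕ) (f : ℕ → ℕ) : Prop :=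
  Antitone f ∧ ∃ K, ∀ L, K ≤ L → ∑ i ∈ Finset.range L, f i = n

/-- The number of profiles of size `n` satisfying `P`. -/
noncomputable def cnt (n : ℕ) (P : (ℕ → ℕ) → Prop) : ℕ :=
  {f : ℕ → ℕ | IsProfile n f ∧ P f}.ncard

/-- The conjugate of `l`: entry `w` is the number of parts larger than `w`. -/
def profile {n : ℕ} (l : n.Partition) (w : ℕ) : ℕ :=
  l.parts.countP (fun x => w < x)

theorem sum_range_ite_lt (a K : ℕ) (h : a ≤ K) :
    ∑ i ∈ Finset.range K, (if i < a then 1 else 0) = a := by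
  rw [Finset.sum_ite, Finset.sum_const_zero, add_zero, Finset.sum_const, smul_eq_mul, mul_one]
  have : Finset.filter (fun i => i < a) (Finset.range K) = Finset.range a := by
    ext i; simp only [Finset.mem_filter, Finset.mem_range]; omega
  rw [this, Finset.card_range]

theorem sum_range_countP_lt (s : Multiset ℕ) (K : ℕ) (h : ∀ x ∈ s, x ≤ K) :
    ∑ w ∈ Finset.range K, s.countP (fun x => w < x) = s.sum := by
  induction s using Multiset.induction_on with
  | empty => simp
  | cons a s ih =>
    simp only [Multiset.countP_cons, Finset.sum_add_distrib, Multiset.sum_cons]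
    rw [ih (fun x hx => h x (Multiset.mem_cons_of_mem hx)),
      sum_range_ite_lt a K (h a (Multiset.mem_cons_self a s)), add_comm]

theorem countP_lt_add_count (s : Multiset ℕ) (w : ℕ) :
    s.countP (fun x => w + 1 < x) + s.count (w + 1) = s.countP (fun x => w < x) := by
  induction s using Multiset.induction_on with
  | empty => simp
  | cons a s ih =>
    simp only [Multiset.countP_cons, Multiset.count_cons]
    split_ifs <;> omega

theorem IsProfile.exists_tail {n : ℕ} {f : ℕ → ℕ} (hf : IsProfile n f) :
    ∃ K, (∀ L, K ≤ L → ∑ i ∈ Finset.range L, f i = n) ∧ ∀ i, K ≤ i → f i = 0 := by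
  obtain ⟨K, hK⟩ := hf.2
  refine ⟨K, hK, fun i hi => ?_⟩
  have h1 := hK i hi
  have h2 := hK (i + 1) (by omega)
  rw [Finset.sum_range_succ] at h2
  omega

theorem IsProfile.succ_le {n : ℕ} {f : ℕ → ℕ} (hf : IsProfile n f) (i : ℕ) :
    f (i + 1) ≤ f i :=
  hf.1 (Nat.le_succ i)

theorem IsProfile.sum_le {n : ℕ} {f : ℕ → ℕ} (hf : IsProfile n f) (L : ℕ) :
    ∑ i ∈ Finset.range L, f i ≤ n := by
  obtain ⟨K, hK⟩ := hf.2
  rw [← hK (max K L) (le_max_left _ _)]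
  exact Finset.sum_le_sum_of_subset (Finset.range_mono (le_max_right _ _))

theorem IsProfile.mul_le {n : ℕ} {f : ℕ → ℕ} (hf : IsProfile n f) (i : ℕ) :
    (i + 1) * f i ≤ n := by
  refine le_trans ?_ (hf.sum_le (i + 1))
  have := Finset.card_nsmul_le_sum (Finset.range (i + 1)) f (f i)
    (fun x hx => hf.1 (by simp at hx; omega))
  simpa using this

theorem IsProfile.apply_le {n : ℕ} {f : ℕ → ℕ} (hf : IsProfile n f) (i : ℕ) : f i ≤ n :=
  le_trans (Nat.le_mul_of_pos_left _ (Nat.succ_pos i)) (hf.mul_le i)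

theorem IsProfile.lt_of_pos {n : ℕ} {f : ℕ → ℕ} (hf : IsProfile n f) {i : ℕ} (h : 0 < f i) :
    i < n :=
  lt_of_lt_of_le (Nat.lt_succ_self i) (le_trans (Nat.le_mul_of_pos_right _ h) (hf.mul_le i))

theorem isProfile_profile {n : ℕ} (l : n.Partition) : IsProfile n (profile l) := by
  refine ⟨fun a b hab => ?_, n, fun L hL => ?_⟩
  · unfold profile
    rw [Multiset.countP_eq_card_filter, Multiset.countP_eq_card_filter]
    exact Multiset.card_le_card
      (Multiset.monotone_filter_right _ (fun x (hx : b < x) => lt_of_le_of_lt hab hx))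
  · unfold profile
    rw [sum_range_countP_lt, l.parts_sum]
    intro x hx
    exact le_trans (le_trans (Multiset.single_le_sum (fun _ _ => Nat.zero_le _) x hx)
      l.parts_sum.le) hL

theorem profile_injective (n : ℕ) : Function.Injective (profile (n := n)) := by
  intro l l' h
  refine Nat.Partition.ext (Multiset.ext.2 fun x => ?_)
  cases x with
  | zero =>
    rw [Multiset.count_eq_zero_of_notMem (fun h => lt_irrefl _ (l.parts_pos h)),
      Multiset.count_eq_zero_of_notMem (fun h => lt_irrefl _ (l'.parts_pos h))]
  | succ w =>
    have h1 := countP_lt_add_count l.parts w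
    have h2 := countP_lt_add_count l'.parts w
    have h3 := congrFun h w
    have h4 := congrFun h (w + 1)
    unfold profile at h3 h4
    omega

theorem exists_profile_eq {n : ℕ} {f : ℕ → ℕ} (hf : IsProfile n f) :
    ∃ l : n.Partition, profile l = f := by
  obtain ⟨K, hK, hK0⟩ := hf.exists_tail
  set s : ℕ → Multiset ℕ := fun K =>
    ∑ w ∈ Finset.range K, Multiset.replicate (f w - f (w + 1)) (w + 1) with hs
  have hmem : ∀ K, ∀ x ∈ s K, 0 < x ∧ x ≤ K := by
    intro K x hx
    rw [hs, Multiset.mem_sum] at hx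
    obtain ⟨w, hw, hx⟩ := hx
    have := Multiset.eq_of_mem_replicate hx
    have := Finset.mem_range.1 hw
    omega
  have hcount : ∀ K v, (s K).countP (fun x => v < x) + f (max v K) = f v := by
    intro K v
    induction K with
    | zero => simp [hs]
    | succ K ih =>
      have h1 : s (K + 1) = s K + Multiset.replicate (f K - f (K + 1)) (K + 1) :=
        Finset.sum_range_succ _ _
      have h2 : f (K + 1) ≤ f K := hf.1 (Nat.le_succ K)
      rw [h1, Multiset.countP_add, ← Multiset.coe_replicate, Multiset.coe_countP,
        List.countP_replicate]
      by_cases hv : v ≤ K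
      · rw [max_eq_right hv] at ih
        rw [if_pos (by simpa using by omega), max_eq_right (by omega)]
        omega
      · rw [max_eq_left (by omega)] at ih
        rw [if_neg (by simpa using by omega), max_eq_left (by omega)]
        omega
  have hcount' : ∀ v, (s K).countP (fun x => v < x) = f v := by
    intro v
    have := hcount K v
    rw [hK0 _ (le_max_right _ _)] at this
    simpa using this
  refine ⟨⟨s K, fun {x} hx => (hmem K x hx).1, ?_⟩, funext hcount'⟩
  rw [← sum_range_countP_lt (s K) K (fun x hx => (hmem K x hx).2), ← hK K le_rfl]
  exact Finset.sum_congr rfl fun v _ => hcount' v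

theorem finite_profiles (n : ℕ) (P : (ℕ → ℕ) → Prop) :
    {f : ℕ → ℕ | IsProfile n f ∧ P f}.Finite := by
  refine (Set.finite_range (profile (n := n))).subset fun f hf => ?_
  exact exists_profile_eq hf.1

theorem card_partition_eq_cnt (n : ℕ) (A : n.Partition → Prop) (P : (ℕ → ℕ) → Prop)
    (h : ∀ l, A l ↔ P (profile l)) : Nat.card {l // A l} = cnt n P := by
  have : Nat.card {l // A l} = {l | A l}.ncard := rfl
  rw [this, cnt]
  refine Set.ncard_congr (fun l _ => profile l)
    (fun l hl => ⟨isProfile_profile l, (h l).1 hl⟩)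
    (fun _ _ _ _ hll => profile_injective n hll) fun f hf => ?_
  obtain ⟨l, rfl⟩ := exists_profile_eq hf.1
  exact ⟨l, (h l).2 hf.2, rfl⟩

theorem profile_zero {n : ℕ} (l : n.Partition) : profile l 0 = l.parts.card :=
  Multiset.countP_eq_card.2 fun _ hx => l.parts_pos hx

theorem profile_one_add_count {n : ℕ} (l : n.Partition) :
    profile l 1 + l.parts.count 1 = profile l 0 :=
  countP_lt_add_count l.parts 0

theorem lt_part_one_iff {n : ℕ} (l : n.Partition) (w : ℕ) :
    w < part l 1 ↔ 0 < profile l w := by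
  unfold profile part
  rw [Multiset.countP_pos]
  have hmem : ∀ x, x ∈ (l.parts.sort (· ≤ ·)).reverse ↔ x ∈ l.parts := by
    intro x; simp
  have hs : ((l.parts.sort (· ≤ ·)).reverse).Pairwise (fun a b => b ≤ a) := by
    rw [List.pairwise_reverse]
    exact Multiset.pairwise_sort _ _
  generalize (l.parts.sort (· ≤ ·)).reverse = L at hmem hs
  cases L with
  | nil =>
    simp only [List.not_mem_nil, false_iff] at hmem
    simp [hmem]
  | cons a t =>
    simp only [Nat.sub_self, List.getD_cons_zero]
    constructor
    · exact fun h => ⟨a, (hmem a).1 List.mem_cons_self, h⟩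
    · rintro ⟨x, hx, hwx⟩
      rcases List.mem_cons.1 ((hmem x).2 hx) with rfl | hx
      · exact hwx
      · exact lt_of_lt_of_le hwx ((List.pairwise_cons.1 hs).1 x hx)

/-- `f` has exactly `m` nonzero entries. -/
def HasLength (m : ℕ) (f : ℕ → ℕ) : Prop := ∀ w, w < m ↔ 0 < f w

theorem crank_eq_iff {n : ℕ} (l : n.Partition) (m : ℕ) :
    crank l = m ↔ (HasLength m (profile l) ∧ ¬ profile l 1 < profile l 0) ∨
      ∃ w, 1 ≤ w ∧ w + profile l 1 = profile l 0 ∧ profile l w = w + m := by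
  have h1 := profile_one_add_count l
  unfold crank
  split_ifs with h
  · have h2 : part l 1 = m ↔ HasLength m (profile l) := by
      constructor
      · rintro rfl w
        exact lt_part_one_iff l w
      · intro hm
        have h3 := (hm (part l 1)).trans (lt_part_one_iff l _).symm
        have h4 := (lt_part_one_iff l m).trans (hm m).symm
        omega
    rw [Nat.cast_inj, h2]
    constructor
    · exact fun hm => Or.inl ⟨hm, by omega⟩
    · rintro (h | ⟨w, hw⟩)
      · exact h.1
      · omega
  · have h2 : (l.parts.filter (fun x => l.parts.count 1 < x)).card =
        profile l (l.parts.count 1) := (Multiset.countP_eq_card_filter _ _).symm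
    rw [h2]
    constructor
    · exact fun hm => Or.inr ⟨l.parts.count 1, by omega, by omega, by omega⟩
    · rintro (h | ⟨w, hw1, hw2, hw3⟩)
      · omega
      · have : l.parts.count 1 = w := by omega
        rw [this]; omega

theorem lt_rank_iff {n : ℕ} (l : n.Partition) (k : ℕ) :
    (k : ℤ) < rank l ↔ 0 < profile l (profile l 0 + k) := by
  rw [← lt_part_one_iff, profile_zero, rank]
  omega

theorem ncard_eq_of_rel {α β : Type*} {A : Set α} {B : Set β} (R : α → β → Prop)
    (hA : ∀ a ∈ A, ∃ b ∈ B, R a b) (hB : ∀ b ∈ B, ∃ a ∈ A, R a b)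
    (hR : ∀ a ∈ A, ∀ b ∈ B, ∀ b' ∈ B, R a b → R a b' → b = b')
    (hL : ∀ b ∈ B, ∀ a ∈ A, ∀ a' ∈ A, R a b → R a' b → a = a') : A.ncard = B.ncard := by
  choose F hF hFR using hA
  refine Set.ncard_congr F hF (fun a a' ha ha' h => ?_) fun b hb => ?_
  · exact hL (F a ha) (hF a ha) a ha a' ha' (hFR a ha) (by rw [h]; exact hFR a' ha')
  · obtain ⟨a, ha, hab⟩ := hB b hb
    exact ⟨a, ha, hR a ha _ (hF a ha) _ hb (hFR a ha) hab⟩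

theorem IsProfile.of_tail_eq {n n' : ℕ} {f g : ℕ → ℕ} (hf : IsProfile n f)
    (hg : ∀ i, g (i + 1) ≤ g i) (J J' A B : ℕ) (htail : ∀ i, g (J + i) = f (J' + i))
    (hsum : ∑ i ∈ Finset.range J, g i + A = ∑ i ∈ Finset.range J', f i + B)
    (hn : n' + A = n + B) : IsProfile n' g := by
  refine ⟨antitone_nat_of_succ_le hg, ?_⟩
  obtain ⟨K, hK⟩ := hf.2
  refine ⟨K + J, fun L hL => ?_⟩
  have h1 := hK (J' + (L - J)) (by omega)
  have h2 : L = J + (L - J) := by omega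
  rw [h2, Finset.sum_range_add]
  rw [Finset.sum_range_add] at h1
  rw [Finset.sum_congr rfl (fun i _ => htail i)]
  omega

theorem cnt_congr {n : ℕ} {P Q : (ℕ → ℕ) → Prop} (h : ∀ f, IsProfile n f → (P f ↔ Q f)) :
    cnt n P = cnt n Q := by
  unfold cnt
  congr 1
  ext f
  exact and_congr_right (h f)

theorem cnt_eq_zero {n : ℕ} {P : (ℕ → ℕ) → Prop} (h : ∀ f, IsProfile n f → ¬ P f) :
    cnt n P = 0 := by
  unfold cnt
  have : {f | IsProfile n f ∧ P f} = ∅ := by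
    ext f; simpa using h f
  rw [this, Set.ncard_empty]

theorem cnt_pos {n : ℕ} {P : (ℕ → ℕ) → Prop} {f : ℕ → ℕ} (hf : IsProfile n f) (h : P f) :
    0 < cnt n P :=
  (Set.ncard_pos (finite_profiles n P)).2 ⟨f, hf, h⟩

theorem cnt_add_of_split {n : ℕ} {P Q R : (ℕ → ℕ) → Prop}
    (h : ∀ f, IsProfile n f → (P f ↔ Q f ∨ R f)) (hd : ∀ f, IsProfile n f → Q f → ¬ R f) :
    cnt n P = cnt n Q + cnt n R := by
  unfold cnt
  rw [← Set.ncard_union_eq _ (finite_profiles n Q) (finite_profiles n R)]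
  · congr 1
    ext f
    simp only [Set.mem_ofPred_eq, Set.mem_union, ← and_or_left]
    exact and_congr_right (h f)
  · rw [Set.disjoint_left]
    exact fun f hf hf' => hd f hf.1 hf.2 hf'.2

theorem cnt_and_add_cnt_and_not (n : ℕ) (P Q : (ℕ → ℕ) → Prop) :
    cnt n P = cnt n (fun f => Q f ∧ P f) + cnt n (fun f => P f ∧ ¬ Q f) :=
  cnt_add_of_split (fun f _ => by tauto) (fun f _ => by tauto)

/-- Adding a part equal to `b`. -/
def bump (b : ℕ) (f : ℕ → ℕ) (i : ℕ) : ℕ := if i < b then f i + 1 else f i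

theorem IsProfile.bump {n : ℕ} {f : ℕ → ℕ} (hf : IsProfile n f) (b : ℕ) :
    IsProfile (n + b) (bump b f) := by
  refine hf.of_tail_eq (fun i => ?_) b b 0 b (fun i => ?_) ?_ (by omega)
  · have := hf.succ_le i
    unfold RankCrank.bump
    split_ifs <;> omega
  · unfold RankCrank.bump
    rw [if_neg (by omega)]
  · rw [Finset.sum_congr rfl (g := fun i => f i + 1), Finset.sum_add_distrib]
    · simp
    · intro i hi
      exact if_pos (Finset.mem_range.1 hi)

theorem cnt_bump {n b : ℕ} (hb : 1 ≤ b) {P Q : (ℕ → ℕ) → Prop}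
    (h : ∀ f, IsProfile n f → (P f ↔ Q (bump b f))) :
    cnt n P = cnt (n + b) (fun g => g b < g (b - 1) ∧ Q g) := by
  unfold cnt
  refine Set.ncard_congr (fun f _ => bump b f) ?_ ?_ ?_
  · rintro f ⟨hf, hP⟩
    refine ⟨hf.bump b, ?_, (h f hf).1 hP⟩
    have := hf.1 (Nat.sub_le b 1)
    unfold bump
    rw [if_neg (lt_irrefl b), if_pos (by omega)]
    omega
  · intro f g _ _ hfg
    funext i
    have := congrFun hfg i
    simp only [bump] at this
    split_ifs at this <;> omega
  · rintro g ⟨hg, hgb, hQ⟩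
    have hpos : ∀ i, i < b → g b < g i := fun i hi =>
      lt_of_lt_of_le hgb (hg.1 (by omega))
    set f : ℕ → ℕ := fun i => if i < b then g i - 1 else g i with hfdef
    have hfg : bump b f = g := by
      funext i
      have := hpos i
      simp only [bump, hfdef]
      split_ifs <;> omega
    have hf : IsProfile n f := by
      refine hg.of_tail_eq (fun i => ?_) b b b 0 (fun i => ?_) ?_ (by omega)
      · have h1 := hg.succ_le i
        have h2 := hpos i
        simp only [hfdef]
        rcases lt_trichotomy (i + 1) b with h | h | h
        · rw [if_pos h, if_pos (by omega)]; omega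
        · subst h
          rw [if_neg (lt_irrefl _), if_pos (by omega)]; omega
        · rw [if_neg (by omega), if_neg (by omega)]; omega
      · simp only [hfdef]
        rw [if_neg (by omega)]
      · conv_rhs => rw [← hfg]
        rw [add_zero, Finset.sum_congr (f := bump b f) rfl (g := fun i => f i + 1),
          Finset.sum_add_distrib]
        · simp
        · intro i hi
          exact if_pos (Finset.mem_range.1 hi)
    exact ⟨f, ⟨hf, (h f hf).2 (by rwa [hfg])⟩, hfg⟩

theorem IsProfile.le_of_lt_apply {n b : ℕ} {f : ℕ → ℕ} (hf : IsProfile n f) (hb : 1 ≤ b)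
    (h : f b < f (b - 1)) : b ≤ n := by
  have := hf.lt_of_pos (i := b - 1) (by omega)
  omega

/-- Conjugation preserves profiles. -/
theorem IsProfile.exists_conj {n : ℕ} {f : ℕ → ℕ} (hf : IsProfile n f) :
    ∃ g, IsProfile n g ∧ ∀ i j, i < g j ↔ j < f i := by
  obtain ⟨K, hK, hK0⟩ := hf.exists_tail
  have hex : ∀ j, ∃ i, f i ≤ j := fun j => ⟨K, by rw [hK0 K le_rfl]; exact Nat.zero_le _⟩
  set g : ℕ → ℕ := fun j => Nat.find (hex j) with hg
  have hR : ∀ i j, i < g j ↔ j < f i := by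
    intro i j
    simp only [hg, Nat.lt_find_iff, not_le]
    exact ⟨fun h => h i le_rfl, fun h m hm => lt_of_lt_of_le h (hf.1 hm)⟩
  refine ⟨g, ⟨?_, n, fun L hL => ?_⟩, hR⟩
  · intro a b hab
    by_contra hlt
    have h1 := (hR _ _).1 (not_le.1 hlt)
    exact lt_irrefl _ ((hR (g a) a).2 (lt_of_le_of_lt hab h1))
  · have hgK : ∀ j, g j ≤ K := fun j => Nat.find_min' (hex j) (by rw [hK0 K le_rfl]; omega)
    rw [← hK K le_rfl, Finset.sum_congr rfl
      (fun j _ => (sum_range_ite_lt (g j) K (hgK j)).symm), Finset.sum_comm]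
    refine Finset.sum_congr rfl fun i _ => ?_
    simp only [hR]
    exact sum_range_ite_lt (f i) L ((hf.apply_le i).trans hL)

theorem cnt_hasLength (n m : ℕ) : cnt n (HasLength m) = cnt n (fun f => f 0 = m) := by
  have huniq : ∀ f g g' : ℕ → ℕ, (∀ i j, i < g j ↔ j < f i) → (∀ i j, i < g' j ↔ j < f i) →
      g = g' := by
    intro f g g' h h'
    funext j
    have h1 := (h (g j) j).trans (h' (g j) j).symm
    have h2 := (h (g' j) j).trans (h' (g' j) j).symm
    omega
  refine ncard_eq_of_rel (fun f g => ∀ i j, i < g j ↔ j < f i) ?_ ?_ ?_ ?_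
  · rintro f ⟨hf, hm⟩
    obtain ⟨g, hg, hR⟩ := hf.exists_conj
    refine ⟨g, ⟨hg, ?_⟩, hR⟩
    have h1 := (hR (g 0) 0).trans (hm (g 0)).symm
    have h2 := (hR m 0).trans (hm m).symm
    omega
  · rintro g ⟨hg, rfl⟩
    obtain ⟨f, hf, hR⟩ := hg.exists_conj
    exact ⟨f, ⟨hf, fun w => (hR 0 w).symm⟩, fun i j => (hR j i).symm⟩
  · exact fun f _ g _ g' _ => huniq f g g'
  · exact fun g _ f _ f' _ h h' =>
      huniq g f f' (fun i j => (h j i).symm) (fun i j => (h' j i).symm)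

/-- `-m` lies in the rank-set. -/
def Crosses (m : ℕ) (f : ℕ → ℕ) : Prop := ∃ j, f j = j + m

theorem cross_unique {f : ℕ → ℕ} (hf : Antitone f) {m i j : ℕ} (hi : f i = i + m)
    (hj : f j = j + m) : i = j := by
  rcases le_total i j with h | h <;> have := hf h <;> omega

theorem cnt_crosses_add (n m : ℕ) :
    cnt (n + m) (Crosses m) + cnt n (Crosses (m + 1)) = cnt n (fun _ => True) := by
  have key : cnt (n + m) (Crosses m) = cnt n (fun f => ¬ Crosses (m + 1) f) := by
    refine ncard_eq_of_rel (fun f t => ∃ j, f j = j + m ∧ (∀ i, i < j → t i = f i + 1) ∧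
      ∀ i, j ≤ i → t i = f (i + 1)) ?_ ?_ ?_ ?_
    · rintro f ⟨hf, j, hj⟩
      have hanti : Antitone (fun i => if i < j then f i + 1 else f (i + 1)) := by
        refine antitone_nat_of_succ_le fun i => ?_
        have h1 := hf.succ_le i
        have h2 := hf.succ_le (i + 1)
        split_ifs <;> omega
      refine ⟨fun i => if i < j then f i + 1 else f (i + 1), ⟨?_, ?_⟩, j, hj, ?_, ?_⟩
      · refine hf.of_tail_eq (fun i => hanti (Nat.le_succ i)) j (j + 1) (j + m) j ?_ ?_ ?_
        · intro i
          rw [if_neg (by omega)]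
          congr 1; omega
        · rw [Finset.sum_congr rfl (g := fun i => f i + 1), Finset.sum_add_distrib,
            Finset.sum_range_succ, hj]
          · simp; omega
          · intro i hi
            exact if_pos (Finset.mem_range.1 hi)
        · omega
      · rintro ⟨v, hv⟩
        dsimp only at hv
        split_ifs at hv with h
        · have := hf.1 h.le; omega
        · have := hf.1 (show j ≤ v + 1 by omega); omega
      · intro i hi; exact if_pos hi
      · intro i hi; exact if_neg (by omega)
    · rintro t ⟨ht, hno⟩
      have hex : ∃ j, t j ≤ j + m := ⟨t 0, (ht.1 (Nat.zero_le _)).trans (Nat.le_add_right _ _)⟩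
      obtain ⟨j, hj, hjmin⟩ : ∃ j, t j ≤ j + m ∧ ∀ i, i < j → j + m + 1 ≤ t i := by
        refine ⟨Nat.find hex, Nat.find_spec hex, fun i hi => ?_⟩
        have h1 := Nat.find_min hex (m := Nat.find hex - 1) (by omega)
        have h2 : t (Nat.find hex - 1) ≠ Nat.find hex - 1 + (m + 1) := fun h => hno ⟨_, h⟩
        have h3 := ht.1 (show i ≤ Nat.find hex - 1 by omega)
        omega
      set f : ℕ → ℕ := fun i => if i < j then t i - 1 else if i = j then j + m else t (i - 1)
        with hfdef
      have f1 : ∀ i, i < j → f i = t i - 1 := fun i hi => if_pos hi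
      have f2 : f j = j + m := by simp [hfdef]
      have f3 : ∀ i, j ≤ i → f (i + 1) = t i := fun i hi => by
        simp only [hfdef]
        rw [if_neg (by omega), if_neg (by omega), Nat.add_sub_cancel]
      refine ⟨f, ⟨?_, j, f2⟩, j, f2, ?_, fun i hi => (f3 i hi).symm⟩
      · refine ht.of_tail_eq (fun i => ?_) (j + 1) j j (j + m) ?_ ?_ (by omega)
        · rcases lt_trichotomy (i + 1) j with h | h | h
          · rw [f1 _ h, f1 i (by omega)]
            have := ht.succ_le i; omega
          · rw [h, f2, f1 i (by omega)]
            have := hjmin i (by omega); omega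
          · rcases eq_or_lt_of_le (show j ≤ i by omega) with h' | h'
            · subst h'
              rw [f3 _ le_rfl, f2]; exact hj
            · obtain ⟨k, rfl⟩ : ∃ k, i = k + 1 := ⟨i - 1, by omega⟩
              rw [f3 _ (by omega), f3 _ (by omega)]
              exact ht.succ_le k
        · intro i
          rw [show j + 1 + i = j + i + 1 by omega]
          exact f3 _ (by omega)
        · rw [Finset.sum_range_succ, f2,
            Finset.sum_congr (s₁ := Finset.range j) (f := t) rfl (g := fun i => f i + 1),
            Finset.sum_add_distrib]
          · simp; omega
          · intro i hi
            have hi := Finset.mem_range.1 hi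
            have := hjmin i hi
            rw [f1 i hi]; omega
      · intro i hi
        have := hjmin i hi
        rw [f1 i hi]; omega
    · rintro f ⟨hf, -⟩ t - t' - ⟨j, hj, h1, h2⟩ ⟨j', hj', h1', h2'⟩
      obtain rfl := cross_unique hf.1 hj hj'
      funext i
      rcases lt_or_ge i j with h | h
      · rw [h1 i h, h1' i h]
      · rw [h2 i h, h2' i h]
    · rintro t ⟨ht, -⟩ f ⟨hf, -⟩ f' ⟨hf', -⟩ ⟨j, hj, h1, h2⟩ ⟨j', hj', h1', h2'⟩
      have hle : ∀ f f' : ℕ → ℕ, Antitone f → Antitone f' → ∀ j j', f j = j + m →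
          (∀ i, j ≤ i → t i = f (i + 1)) → f' j' = j' + m →
          (∀ i, i < j' → t i = f' i + 1) → ¬ j < j' := by
        intro f f' hf hf' j j' hj h2 hj' h1' hlt
        have e1 := h2 j le_rfl
        have e3 := h1' j hlt
        have e4 := hf' hlt.le
        have e2 : f (j + 1) ≤ f j := hf (Nat.le_succ j)
        omega
      have : j = j' := by
        have a1 := hle f f' hf.1 hf'.1 j j' hj h2 hj' h1'
        have a2 := hle f' f hf'.1 hf.1 j' j hj' h2' hj h1
        omega
      subst this
      funext i
      rcases lt_trichotomy i j with h | h | h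
      · have := h1 i h; have := h1' i h; omega
      · rw [h, hj, hj']
      · obtain ⟨k, rfl⟩ : ∃ k, i = k + 1 := ⟨i - 1, by omega⟩
        rw [← h2 k (by omega), ← h2' k (by omega)]
  rw [key, add_comm]
  exact (cnt_add_of_split (fun f _ => by tauto) (fun f _ => by tauto)).symm

/-- Dyson's recursion; `0 < f (f 0 + k)` says that the rank exceeds `k`. -/
theorem cnt_rank_add (n k : ℕ) :
    cnt (n + k + 2) (fun f => 0 < f (f 0 + k)) + cnt n (fun f => 0 < f (f 0 + (k + 3))) =
      cnt n (fun _ => True) := by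
  have key : cnt n (fun f => f (f 0 + (k + 3)) = 0) =
      cnt (n + k + 2) (fun f => 0 < f (f 0 + k)) := by
    refine ncard_eq_of_rel (fun t f => (∀ i, i < t 0 + k + 2 → f i = t (i + 1) + 1) ∧
      ∀ i, t 0 + k + 2 ≤ i → f i = 0) ?_ ?_ ?_ ?_
    · rintro t ⟨ht, h0⟩
      have hz : ∀ i, t 0 + k + 2 ≤ i → t (i + 1) = 0 := fun i hi =>
        Nat.le_zero.1 (h0 ▸ ht.1 (show t 0 + (k + 3) ≤ i + 1 by omega))
      set f : ℕ → ℕ := fun i => if i < t 0 + k + 2 then t (i + 1) + 1 else 0 with hf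
      have f1 : ∀ i, i < t 0 + k + 2 → f i = t (i + 1) + 1 := fun i hi => if_pos hi
      have f2 : ∀ i, t 0 + k + 2 ≤ i → f i = 0 := fun i hi => if_neg (by omega)
      refine ⟨f, ⟨?_, ?_⟩, f1, f2⟩
      · refine ht.of_tail_eq (fun i => ?_) (t 0 + k + 2) (t 0 + k + 2 + 1) (t 0)
          (t 0 + k + 2) ?_ ?_ (by omega)
        · rcases lt_or_ge (i + 1) (t 0 + k + 2) with h | h
          · rw [f1 _ h, f1 _ (by omega)]
            have := ht.succ_le (i + 1)
            omega
          · rw [f2 _ h]; exact Nat.zero_le _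
        · intro i
          rw [f2 _ (by omega), show t 0 + k + 2 + 1 + i = t 0 + k + 2 + i + 1 by omega,
            hz _ (by omega)]
        · rw [Finset.sum_range_succ' t, Finset.sum_congr (f := f) rfl
            (g := fun i => t (i + 1) + 1), Finset.sum_add_distrib]
          · simp; omega
          · intro i hi
            exact f1 i (Finset.mem_range.1 hi)
      · have h1 := f1 0 (by omega)
        have h2 : t (0 + 1) ≤ t 0 := ht.1 (Nat.zero_le _)
        change 0 < f (f 0 + k)
        rw [f1 _ (by omega)]
        omega
    · rintro f ⟨hf, h0⟩
      obtain ⟨K, -, hK⟩ := hf.exists_tail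
      have hex : ∃ i, f i = 0 := ⟨K, hK K le_rfl⟩
      obtain ⟨L, hL, hLpos⟩ : ∃ L, f L = 0 ∧ ∀ i, i < L → 0 < f i :=
        ⟨Nat.find hex, Nat.find_spec hex, fun i hi => Nat.pos_of_ne_zero (Nat.find_min hex hi)⟩
      have hL2 : ∀ i, L ≤ i → f i = 0 := fun i hi => Nat.le_zero.1 (hL ▸ hf.1 hi)
      have hL3 : f 0 + k < L := by
        by_contra h
        rw [hL2 _ (not_lt.1 h)] at h0
        exact lt_irrefl _ h0
      have hpos := hLpos 0 (by omega)
      set t : ℕ → ℕ := fun i => if i = 0 then L - (k + 2) else f (i - 1) - 1 with ht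
      have t0 : t 0 = L - (k + 2) := if_pos rfl
      have t1 : ∀ i, t (i + 1) = f i - 1 := fun i => by simp [ht]
      have hLt : L = t 0 + k + 2 := by omega
      refine ⟨t, ⟨?_, ?_⟩, ?_, ?_⟩
      · refine hf.of_tail_eq (fun i => ?_) (L + 1) L L (t 0) ?_ ?_ (by omega)
        · cases i with
          | zero => rw [t1, t0]; omega
          | succ i =>
            rw [t1, t1]
            exact Nat.sub_le_sub_right (hf.succ_le i) 1
        · intro i
          rw [show L + 1 + i = L + i + 1 by omega, t1, hL2 _ (by omega)]
        · rw [Finset.sum_range_succ',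
            Finset.sum_congr (s₁ := Finset.range L) (f := f) rfl (g := fun i => t (i + 1) + 1),
            Finset.sum_add_distrib]
          · simp; omega
          · intro i hi
            have := hLpos i (Finset.mem_range.1 hi)
            rw [t1]; omega
      · change t (t 0 + (k + 3)) = 0
        rw [show t 0 + (k + 3) = L + 1 by omega, t1, hL]
      · intro i hi
        have := hLpos i (by omega)
        rw [t1]; omega
      · intro i hi
        exact hL2 i (by omega)
    · rintro t - f - f' - ⟨h1, h2⟩ ⟨h1', h2'⟩
      funext i
      rcases lt_or_ge i (t 0 + k + 2) with h | h
      · rw [h1 i h, h1' i h]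
      · rw [h2 i h, h2' i h]
    · rintro f - t ⟨ht, htz⟩ t' ⟨ht', htz'⟩ ⟨h1, h2⟩ ⟨h1', h2'⟩
      have h0 : t 0 = t' 0 := by
        have a1 := h1 (t' 0 + k + 2)
        have a2 := h2' (t' 0 + k + 2) le_rfl
        have a3 := h1' (t 0 + k + 2)
        have a4 := h2 (t 0 + k + 2) le_rfl
        omega
      funext i
      cases i with
      | zero => exact h0
      | succ i =>
        rcases lt_or_ge i (t 0 + k + 2) with h | h
        · have a1 := h1 i h
          have a2 := h1' i (by omega)
          omega
        · have b1 := ht.1 (show t 0 + (k + 3) ≤ i + 1 by omega)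
          have b2 := ht'.1 (show t' 0 + (k + 3) ≤ i + 1 by omega)
          omega
  rw [← key]
  exact (cnt_add_of_split (fun f _ => by simp only [true_iff]; omega) (fun f _ => by omega)).symm

theorem cnt_ones_eq (n m : ℕ) :
    cnt n (fun f => ∃ w, 1 ≤ w ∧ w + f 1 ≤ f 0 ∧ f w = w + m) =
      cnt n (fun f => ∃ w, 1 ≤ w ∧ f w = w + m ∧ ∀ v, v < w → f w < f v) := by
  refine ncard_eq_of_rel (fun f g => ∃ w, 1 ≤ w ∧ f w = w + m ∧ g w = w + m ∧
    g 0 + w = f 0 + 1 ∧ (∀ i, 1 ≤ i → i < w → g i = f i + 1) ∧ ∀ i, w ≤ i → g i = f i) ?_ ?_ ?_ ?_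
  · rintro f ⟨hf, w, hw1, hw2, hw3⟩
    set g : ℕ → ℕ := fun i => if i = 0 then f 0 + 1 - w else if i < w then f i + 1 else f i
      with hg
    have g0 : g 0 = f 0 + 1 - w := if_pos rfl
    have g1 : ∀ i, 1 ≤ i → i < w → g i = f i + 1 := fun i h h' => by
      simp only [hg]; rw [if_neg (by omega), if_pos h']
    have g2 : ∀ i, w ≤ i → g i = f i := fun i h => by
      simp only [hg]; rw [if_neg (by omega), if_neg (by omega)]
    have hstep : ∀ i, g (i + 1) ≤ g i := by
      intro i
      have hi := hf.succ_le i
      rcases lt_or_ge (i + 1) w with h | h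
      · cases i with
        | zero => rw [g1 _ le_rfl h, g0]; simp only [zero_add] at *; omega
        | succ i => rw [g1 _ (by omega) h, g1 _ (by omega) (by omega)]; omega
      · rw [g2 _ h]
        cases i with
        | zero => rw [g0]; simp only [zero_add]; omega
        | succ i =>
          rcases lt_or_ge (i + 1) w with h' | h'
          · rw [g1 _ (by omega) h']; omega
          · rw [g2 _ h']; exact hi
    refine ⟨g, ⟨?_, w, hw1, by rw [g2 _ le_rfl, hw3], ?_⟩, w, hw1, hw3,
      by rw [g2 _ le_rfl, hw3], by omega, g1, g2⟩
    · refine hf.of_tail_eq hstep w w 0 0 (fun i => g2 _ (by omega)) ?_ rfl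
      obtain ⟨u, rfl⟩ : ∃ u, w = u + 1 := ⟨w - 1, by omega⟩
      rw [Finset.sum_range_succ' g, Finset.sum_range_succ' f,
        Finset.sum_congr rfl (g := fun i => f (i + 1) + 1), Finset.sum_add_distrib]
      · simp; omega
      · intro i hi
        exact g1 _ (by omega) (by simpa using hi)
    · intro v hv
      rw [g2 _ le_rfl]
      cases v with
      | zero => have := hf.1 hw1; rw [g0]; omega
      | succ v => have := hf.1 hv.le; rw [g1 _ (by omega) hv]; omega
  · rintro g ⟨hg, w, hw1, hw2, hw3⟩
    set f : ℕ → ℕ := fun i => if i = 0 then g 0 + w - 1 else if i < w then g i - 1 else g i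
      with hf
    have f0 : f 0 = g 0 + w - 1 := if_pos rfl
    have f1 : ∀ i, 1 ≤ i → i < w → f i = g i - 1 := fun i h h' => by
      simp only [hf]; rw [if_neg (by omega), if_pos h']
    have f2 : ∀ i, w ≤ i → f i = g i := fun i h => by
      simp only [hf]; rw [if_neg (by omega), if_neg (by omega)]
    have hstep : ∀ i, f (i + 1) ≤ f i := by
      intro i
      have hi := hg.succ_le i
      rcases lt_or_ge (i + 1) w with h | h
      · cases i with
        | zero => rw [f1 _ le_rfl h, f0]; simp only [zero_add] at *; omega
        | succ i => rw [f1 _ (by omega) h, f1 _ (by omega) (by omega)]; omega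
      · rw [f2 _ h]
        cases i with
        | zero => rw [f0]; simp only [zero_add] at *; omega
        | succ i =>
          rcases lt_or_ge (i + 1) w with h' | h'
          · have h3 := hw3 _ h'
            have h4 : i + 1 + 1 = w := by omega
            rw [f1 _ (by omega) h', h4]; omega
          · rw [f2 _ h']; exact hi
    have hg0 := hw3 0 (by omega)
    refine ⟨f, ⟨?_, w, hw1, ?_, by rw [f2 _ le_rfl, hw2]⟩, w, hw1, by rw [f2 _ le_rfl, hw2],
      hw2, by omega, fun i h h' => ?_, fun i h => (f2 i h).symm⟩
    · refine hg.of_tail_eq hstep w w 0 0 (fun i => f2 _ (by omega)) ?_ rfl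
      obtain ⟨u, rfl⟩ : ∃ u, w = u + 1 := ⟨w - 1, by omega⟩
      rw [Finset.sum_range_succ' g, Finset.sum_range_succ' f,
        Finset.sum_congr (f := fun i => g (i + 1)) rfl (g := fun i => f (i + 1) + 1),
        Finset.sum_add_distrib]
      · simp; omega
      · intro i hi
        have hi : i + 1 < u + 1 := by simpa using hi
        have := hw3 _ hi
        rw [f1 _ (by omega) hi]; omega
    · rcases eq_or_lt_of_le hw1 with rfl | h
      · rw [f2 _ le_rfl, f0]; omega
      · have := hw3 1 h
        have := hg.1 (Nat.zero_le 1)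
        rw [f1 _ le_rfl h, f0]; omega
    · have := hw3 i h'
      rw [f1 i h h']; omega
  · rintro f ⟨hf, -⟩ g - g' - ⟨w, hw, h1, h2, h3, h4, h5⟩ ⟨w', hw', h1', h2', h3', h4', h5'⟩
    obtain rfl := cross_unique hf.1 h1 h1'
    funext i
    rcases lt_or_ge i w with h | h
    · cases i with
      | zero => omega
      | succ i => rw [h4 _ (by omega) h, h4' _ (by omega) h]
    · rw [h5 i h, h5' i h]
  · rintro g ⟨hg, -⟩ f - f' - ⟨w, hw, h1, h2, h3, h4, h5⟩ ⟨w', hw', h1', h2', h3', h4', h5'⟩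
    obtain rfl := cross_unique hg.1 h2 h2'
    funext i
    rcases lt_or_ge i w with h | h
    · cases i with
      | zero => omega
      | succ i =>
        have := h4 _ (by omega) h
        have := h4' _ (by omega) h
        omega
    · rw [← h5 i h, ← h5' i h]

/-- Adding a cell of content `m` turns an addable corner into a removable one. -/
theorem cnt_addable_eq (n m : ℕ) :
    cnt n (fun f => ∃ w, f w = w + m ∧ ∀ v, v < w → f w < f v) =
      cnt (n + 1) (fun g => ∃ w, g w = w + m + 1 ∧ g (w + 1) ≤ w + m) := by
  refine ncard_eq_of_rel (fun f g => ∃ w, f w = w + m ∧ g w = w + m + 1 ∧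
    ∀ i, i ≠ w → g i = f i) ?_ ?_ ?_ ?_
  · rintro f ⟨hf, w, hw1, hw2⟩
    set g : ℕ → ℕ := fun i => if i = w then w + m + 1 else f i with hg
    have g0 : g w = w + m + 1 := if_pos rfl
    have g1 : ∀ i, i ≠ w → g i = f i := fun i h => if_neg h
    refine ⟨g, ⟨hf.of_tail_eq (fun i => ?_) (w + 1) (w + 1) 0 1
      (fun i => g1 _ (by omega)) ?_ (by omega), w, g0, ?_⟩, w, hw1, g0, g1⟩
    · have hi := hf.succ_le i
      rcases eq_or_ne i w with rfl | h
      · rw [g0, g1 _ (by omega)]; omega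
      · rw [g1 i h]
        rcases eq_or_ne (i + 1) w with h' | h'
        · have := hw2 i (by omega)
          rw [h', g0]; omega
        · rw [g1 _ h']; exact hi
    · rw [Finset.sum_range_succ, Finset.sum_range_succ, g0, hw1, Finset.sum_congr rfl (g := fun i => f i)]
      · omega
      · intro i hi
        exact g1 i (Finset.mem_range.1 hi).ne
    · have := hf.succ_le w
      rw [g1 _ (by omega)]; omega
  · rintro g ⟨hg, w, hw1, hw2⟩
    set f : ℕ → ℕ := fun i => if i = w then w + m else g i with hf
    have f0 : f w = w + m := if_pos rfl
    have f1 : ∀ i, i ≠ w → f i = g i := fun i h => if_neg h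
    refine ⟨f, ⟨hg.of_tail_eq (fun i => ?_) (w + 1) (w + 1) 1 0
      (fun i => f1 _ (by omega)) ?_ (by omega), w, f0, fun v hv => ?_⟩, w, f0, hw1,
      fun i h => (f1 i h).symm⟩
    · have hi := hg.succ_le i
      rcases eq_or_ne i w with rfl | h
      · rw [f0, f1 _ (by omega)]; exact hw2
      · rw [f1 i h]
        rcases eq_or_ne (i + 1) w with h' | h'
        · rw [h'] at hi ⊢
          rw [f0]; omega
        · rw [f1 _ h']; exact hi
    · rw [Finset.sum_range_succ, Finset.sum_range_succ, f0, hw1, Finset.sum_congr rfl (g := fun i => g i)]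
      · omega
      · intro i hi
        exact f1 i (Finset.mem_range.1 hi).ne
    · have := hg.1 hv.le
      rw [f0, f1 v hv.ne]; omega
  · rintro f ⟨hf, -⟩ g - g' - ⟨w, h1, h2, h3⟩ ⟨w', h1', h2', h3'⟩
    obtain rfl := cross_unique hf.1 h1 h1'
    funext i
    rcases eq_or_ne i w with rfl | h
    · rw [h2, h2']
    · rw [h3 i h, h3' i h]
  · rintro g ⟨hg, -⟩ f - f' - ⟨w, h1, h2, h3⟩ ⟨w', h1', h2', h3'⟩
    obtain rfl := cross_unique hg.1 (m := m + 1) h2 h2'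
    funext i
    rcases eq_or_ne i w with rfl | h
    · rw [h1, h1']
    · rw [← h3 i h, ← h3' i h]

theorem IsProfile.apply_zero_pos {n : ℕ} {f : ℕ → ℕ} (hf : IsProfile n f) (hn : 0 < n) :
    0 < f 0 := by
  obtain ⟨K, hK⟩ := hf.2
  by_contra h
  have h0 : ∀ i, f i = 0 := fun i => by have := hf.1 (Nat.zero_le i); omega
  have := hK K le_rfl
  simp [h0] at this
  omega

theorem card_crank_eq (n m : ℕ) (hn : 0 < n) :
    Nat.card {l : (n + 1).Partition // crank l = m} + cnt (n + 1) (Crosses (m + 1)) =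
      cnt (n + 1) (Crosses m) := by
  rw [card_partition_eq_cnt (n + 1) _ (fun f => (HasLength m f ∧ ¬ f 1 < f 0) ∨
    ∃ w, 1 ≤ w ∧ w + f 1 = f 0 ∧ f w = w + m) (fun l => crank_eq_iff l m)]
  have e1 : cnt (n + 1) (fun f => (HasLength m f ∧ ¬ f 1 < f 0) ∨
      ∃ w, 1 ≤ w ∧ w + f 1 = f 0 ∧ f w = w + m) =
      cnt (n + 1) (fun f => HasLength m f ∧ ¬ f 1 < f 0) +
      cnt (n + 1) (fun f => ∃ w, 1 ≤ w ∧ w + f 1 = f 0 ∧ f w = w + m) :=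
    cnt_add_of_split (fun _ _ => Iff.rfl) (by rintro f - ⟨-, h⟩ ⟨w, hw⟩; omega)
  have e2 := cnt_and_add_cnt_and_not (n + 1) (HasLength m) (fun f => f 1 < f 0)
  have e3 : cnt n (HasLength m) = cnt (n + 1) (fun f => f 1 < f 0 ∧ HasLength m f) := by
    refine cnt_bump (b := 1) le_rfl fun f hf => ?_
    have := hf.apply_zero_pos hn
    refine forall_congr' fun w => iff_congr Iff.rfl ?_
    unfold bump
    split_ifs with h
    · obtain rfl : w = 0 := by omega
      omega
    · rfl
  have e4 : cnt (n + 1) (fun f => ∃ w, 1 ≤ w ∧ w + f 1 ≤ f 0 ∧ f w = w + m) =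
      cnt (n + 1) (fun f => ∃ w, 1 ≤ w ∧ w + f 1 = f 0 ∧ f w = w + m) +
      cnt (n + 1) (fun f => f 1 < f 0 ∧ ∃ w, 1 ≤ w ∧ w + f 1 < f 0 ∧ f w = w + m) := by
    refine cnt_add_of_split (fun f _ => ⟨?_, ?_⟩) fun f hf => ?_
    · rintro ⟨w, h1, h2, h3⟩
      rcases eq_or_lt_of_le h2 with h | h
      · exact Or.inl ⟨w, h1, h, h3⟩
      · exact Or.inr ⟨by omega, w, h1, h, h3⟩
    · rintro (⟨w, h1, h2, h3⟩ | ⟨-, w, h1, h2, h3⟩)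
      · exact ⟨w, h1, h2.le, h3⟩
      · exact ⟨w, h1, h2.le, h3⟩
    · rintro ⟨w, h1, h2, h3⟩ ⟨-, w', h1', h2', h3'⟩
      have := cross_unique hf.1 h3 h3'
      omega
  have e5 : cnt n (fun f => ∃ w, 1 ≤ w ∧ w + f 1 ≤ f 0 ∧ f w = w + m) =
      cnt (n + 1) (fun f => f 1 < f 0 ∧ ∃ w, 1 ≤ w ∧ w + f 1 < f 0 ∧ f w = w + m) := by
    refine cnt_bump (b := 1) le_rfl fun f hf => exists_congr fun w => and_congr_right fun hw => ?_
    unfold bump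
    rw [if_neg (lt_irrefl 1), if_pos Nat.zero_lt_one, if_neg (by omega), Nat.lt_succ_iff]
  have e6 : ∀ k, cnt k (fun f => ∃ w, f w = w + m ∧ ∀ v, v < w → f w < f v) =
      cnt k (fun f => f 0 = m) +
      cnt k (fun f => ∃ w, 1 ≤ w ∧ f w = w + m ∧ ∀ v, v < w → f w < f v) := by
    refine fun k => cnt_add_of_split (fun f _ => ⟨?_, ?_⟩) fun f hf => ?_
    · rintro ⟨w, h1, h2⟩
      cases w with
      | zero => exact Or.inl (by omega)
      | succ w => exact Or.inr ⟨w + 1, by omega, h1, h2⟩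
    · rintro (h | ⟨w, -, h1, h2⟩)
      · exact ⟨0, by omega, fun v hv => absurd hv (Nat.not_lt_zero v)⟩
      · exact ⟨w, h1, h2⟩
    · rintro h0 ⟨w, h1, h2, -⟩
      have := cross_unique (m := m) (i := 0) hf.1 (by omega) h2
      omega
  have e7 : cnt (n + 1) (Crosses m) =
      cnt (n + 1) (fun f => ∃ w, f w = w + m ∧ ∀ v, v < w → f w < f v) +
      cnt (n + 1) (fun f => ∃ w, f w = w + m + 1 ∧ f (w + 1) = w + m + 1) := by
    refine cnt_add_of_split (fun f hf => ⟨?_, ?_⟩) fun f hf => ?_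
    · rintro ⟨w, hw⟩
      by_cases h : ∀ v, v < w → f w < f v
      · exact Or.inl ⟨w, hw, h⟩
      · push Not at h
        obtain ⟨v, hv, hvw⟩ := h
        obtain ⟨u, rfl⟩ : ∃ u, w = u + 1 := ⟨w - 1, by omega⟩
        have h1 := hf.1 (show v ≤ u by omega)
        have h2 := hf.succ_le u
        exact Or.inr ⟨u, by omega, by omega⟩
    · rintro (⟨w, hw, -⟩ | ⟨w, -, hw⟩)
      · exact ⟨w, hw⟩
      · exact ⟨w + 1, by omega⟩
    · rintro ⟨w, hw, hw2⟩ ⟨v, hv, hv2⟩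
      have := cross_unique (i := v + 1) hf.1 (by omega) hw
      have := hw2 v (by omega)
      omega
  have e8 : cnt (n + 1) (Crosses (m + 1)) =
      cnt (n + 1) (fun f => ∃ w, f w = w + m + 1 ∧ f (w + 1) ≤ w + m) +
      cnt (n + 1) (fun f => ∃ w, f w = w + m + 1 ∧ f (w + 1) = w + m + 1) := by
    refine cnt_add_of_split (fun f hf => ⟨?_, ?_⟩) fun f hf => ?_
    · rintro ⟨w, hw⟩
      have := hf.succ_le w
      rcases eq_or_ne (f (w + 1)) (f w) with h | h
      · exact Or.inr ⟨w, by omega, by omega⟩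
      · exact Or.inl ⟨w, by omega, by omega⟩
    · rintro (⟨w, hw, -⟩ | ⟨w, hw, -⟩)
      · exact ⟨w, by omega⟩
      · exact ⟨w, by omega⟩
    · rintro ⟨w, hw, hw2⟩ ⟨v, hv, hv2⟩
      obtain rfl := cross_unique (m := m + 1) (i := v) hf.1 (by omega) hw
      omega
  have e9 := cnt_addable_eq n m
  have e10 := cnt_hasLength n m
  have e11 := cnt_hasLength (n + 1) m
  have e12 := cnt_ones_eq n m
  have e13 := cnt_ones_eq (n + 1) m
  have e14 := e6 n
  have e15 := e6 (n + 1)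
  omega

theorem card_rank_eq (n k : ℕ) :
    Nat.card {l : n.Partition // rank l = ((k + 1 : ℕ) : ℤ)} +
      cnt n (fun f => 0 < f (f 0 + (k + 1))) = cnt n (fun f => 0 < f (f 0 + k)) := by
  rw [card_partition_eq_cnt n _ (fun f => 0 < f (f 0 + k) ∧ ¬ 0 < f (f 0 + (k + 1)))]
  · refine (cnt_add_of_split (fun f hf => ?_) (fun f _ h => h.2)).symm
    have := hf.succ_le (f 0 + k)
    rw [add_assoc] at this
    omega
  · intro l
    rw [← lt_rank_iff, ← lt_rank_iff]
    omega

theorem sum_Icc_zero_eq_sum_range (n : ℕ) (g : ℤ → ℤ) :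
    ∑ m ∈ Finset.Icc (0 : ℤ) (n : ℤ), g m = ∑ m ∈ Finset.range (n + 1), g m := by
  refine (Finset.sum_bij (fun (m : ℕ) _ => (m : ℤ)) ?_ ?_ ?_ ?_).symm
  · intro m hm
    have := Finset.mem_range.1 hm
    exact Finset.mem_Icc.2 ⟨by omega, by omega⟩
  · intro a _ b _ h
    exact_mod_cast h
  · intro b hb
    have := Finset.mem_Icc.1 hb
    exact ⟨b.toNat, Finset.mem_range.2 (by omega), by omega⟩
  · intro a _
    rfl

theorem sum_range_mul_sub_succ (a : ℕ → ℤ) (n : ℕ) :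
    ∑ m ∈ Finset.range (n + 1), (m : ℤ) * (a m - a (m + 1)) =
      ∑ r ∈ Finset.range n, a (r + 1) - n * a (n + 1) := by
  induction n with
  | zero => simp
  | succ n ih =>
    rw [Finset.sum_range_succ, ih, Finset.sum_range_succ _ n]
    push_cast
    ring

theorem ospt_eq (n : ℕ) (hn : 1 < n) :
    ospt n = ∑ r ∈ Finset.range n, (cnt n (Crosses (r + 1)) : ℤ) -
      ∑ r ∈ Finset.range n, (cnt n (fun f => 0 < f (f 0 + r)) : ℤ) := by
  unfold ospt
  rw [sum_Icc_zero_eq_sum_range, sum_Icc_zero_eq_sum_range]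
  congr 1
  · rw [Finset.sum_congr rfl (g := fun m : ℕ => (m : ℤ) *
      ((fun m => (cnt n (Crosses m) : ℤ)) m - (fun m => (cnt n (Crosses m) : ℤ)) (m + 1))),
      sum_range_mul_sub_succ]
    · have : cnt n (Crosses (n + 1)) = 0 := cnt_eq_zero fun f hf ⟨j, hj⟩ => by
        have := hf.apply_le j
        omega
      simp [this]
    · intro m _
      obtain ⟨k, rfl⟩ : ∃ k, n = k + 1 := ⟨n - 1, by omega⟩
      have := card_crank_eq k m (by omega)
      unfold M
      rw [if_neg (by omega)]
      dsimp only
      rw [← this]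
      push_cast
      ring
  · rw [Finset.sum_congr rfl (g := fun m : ℕ => (m : ℤ) *
      ((fun m => (cnt n (fun f => 0 < f (f 0 + (m - 1))) : ℤ)) m -
        (fun m => (cnt n (fun f => 0 < f (f 0 + (m - 1))) : ℤ)) (m + 1))),
      sum_range_mul_sub_succ]
    · have : cnt n (fun f => 0 < f (f 0 + n)) = 0 := cnt_eq_zero fun f hf h => by
        have := hf.lt_of_pos h
        omega
      simp [this]
    · intro m _
      cases m with
      | zero => simp
      | succ k =>
        have := card_rank_eq n k
        unfold N
        simp only [Nat.add_sub_cancel]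
        rw [← this]
        push_cast
        ring

/-- The counting function `cnt`, extended by zero to negative integers. -/
noncomputable def cntZ (P : (ℕ → ℕ) → Prop) (z : ℤ) : ℤ :=
  if z < 0 then 0 else cnt z.toNat P

theorem cntZ_of_neg (P : (ℕ → ℕ) → Prop) {z : ℤ} (h : z < 0) : cntZ P z = 0 := if_pos h

theorem cntZ_natCast (P : (ℕ → ℕ) → Prop) (n : ℕ) : cntZ P n = cnt n P := by
  unfold cntZ
  rw [if_neg (by omega), Int.toNat_natCast]

theorem cntZ_nonneg (P : (ℕ → ℕ) → Prop) (z : ℤ) : 0 ≤ cntZ P z := by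
  unfold cntZ
  split_ifs <;> omega

theorem cntZ_of_lt {P : (ℕ → ℕ) → Prop} {k : ℕ} (h : ∀ n f, IsProfile n f → P f → k ≤ n)
    {z : ℤ} (hz : z < k) : cntZ P z = 0 := by
  rcases lt_or_ge z 0 with h0 | h0
  · exact cntZ_of_neg P h0
  · lift z to ℕ using h0
    rw [cntZ_natCast, cnt_eq_zero, Nat.cast_zero]
    intro f hf hP
    have := h z f hf hP
    omega

theorem cntZ_crosses (m : ℕ) (z : ℤ) :
    cntZ (Crosses m) z = cntZ (fun _ => True) (z - m) - cntZ (Crosses (m + 1)) (z - m) := by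
  rcases lt_or_ge z m with h | h
  · rw [cntZ_of_neg _ (sub_neg.2 h), cntZ_of_neg _ (sub_neg.2 h), sub_zero, cntZ_of_lt _ h]
    rintro n f hf ⟨j, hj⟩
    have := hf.apply_le j
    omega
  · obtain ⟨n, rfl⟩ : ∃ n : ℕ, z = ((n + m : ℕ) : ℤ) := ⟨(z - m).toNat, by omega⟩
    have := cnt_crosses_add n m
    have e : ((n + m : ℕ) : ℤ) - m = (n : ℤ) := by omega
    rw [e, cntZ_natCast, cntZ_natCast, cntZ_natCast]
    omega

theorem cntZ_rank (k : ℕ) (z : ℤ) :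
    cntZ (fun f => 0 < f (f 0 + k)) z = cntZ (fun _ => True) (z - (k + 2 : ℕ)) -
      cntZ (fun f => 0 < f (f 0 + (k + 3))) (z - (k + 2 : ℕ)) := by
  rcases lt_or_ge z (k + 2 : ℕ) with h | h
  · rw [cntZ_of_neg _ (sub_neg.2 h), cntZ_of_neg _ (sub_neg.2 h), sub_zero, cntZ_of_lt _ h]
    intro n f hf hpos
    have h1 := hf.lt_of_pos hpos
    have h2 := hf.1 (Nat.zero_le (f 0 + k))
    omega
  · obtain ⟨n, rfl⟩ : ∃ n : ℕ, z = ((n + k + 2 : ℕ) : ℤ) := ⟨(z - (k + 2 : ℕ)).toNat, by omega⟩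
    have := cnt_rank_add n k
    have e : ((n + k + 2 : ℕ) : ℤ) - (k + 2 : ℕ) = (n : ℤ) := by omega
    rw [e, cntZ_natCast, cntZ_natCast, cntZ_natCast]
    omega

/-- The exponent `n (n - 1) / 2 + n m`. -/
def crankExp : ℕ → ℕ → ℕ
  | 0, _ => 0
  | n + 1, m => crankExp n m + n + m

theorem crankExp_succ_right (n m : ℕ) : crankExp n (m + 1) = crankExp n m + n := by
  induction n with
  | zero => rfl
  | succ n ih => simp only [crankExp, ih]; omega

theorem le_crankExp (n m : ℕ) (hm : 1 ≤ m) : n ≤ crankExp n m := by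
  induction n with
  | zero => exact Nat.zero_le _
  | succ n ih => simp only [crankExp]; omega

theorem le_crankExp_succ (n m : ℕ) : m ≤ crankExp (n + 1) m := Nat.le_add_left _ _

theorem cntZ_crosses_expand (m : ℕ) (z : ℤ) (K : ℕ) :
    cntZ (Crosses m) z =
      ∑ k ∈ Finset.range K, (-1) ^ k * cntZ (fun _ => True) (z - crankExp (k + 1) m) +
        (-1) ^ K * cntZ (Crosses (m + K)) (z - crankExp K m) := by
  induction K with
  | zero => simp [crankExp]
  | succ K ih =>
    have e : z - crankExp K m - (m + K : ℕ) = z - crankExp (K + 1) m := by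
      simp only [crankExp]; push_cast; ring
    rw [ih, Finset.sum_range_succ, cntZ_crosses (m + K), e, add_assoc m K 1]
    ring

theorem cntZ_rank_expand (r : ℕ) (z : ℤ) (K : ℕ) :
    cntZ (fun f => 0 < f (f 0 + r)) z =
      ∑ k ∈ Finset.range K,
        (-1) ^ k * cntZ (fun _ => True) (z - crankExp (k + 1) (r + (k + 1) + 1)) +
        (-1) ^ K * cntZ (fun f => 0 < f (f 0 + (r + 3 * K))) (z - crankExp K (r + K + 1)) := by
  induction K with
  | zero => simp [crankExp]
  | succ K ih =>
    have e : z - crankExp K (r + K + 1) - (r + 3 * K + 2 : ℕ) =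
        z - crankExp (K + 1) (r + (K + 1) + 1) := by
      have := crankExp_succ_right K (r + K + 1)
      have e2 : r + (K + 1) + 1 = r + K + 1 + 1 := by omega
      rw [e2]
      simp only [crankExp, this]; push_cast; ring
    rw [ih, Finset.sum_range_succ, cntZ_rank (r + 3 * K), e,
      show r + 3 * K + 3 = r + 3 * (K + 1) by ring]
    ring

theorem ospt_eq_sum (n : ℕ) (hn : 1 < n) (K : ℕ) (hK : n < K) :
    ospt n = ∑ k ∈ Finset.range K, (-1) ^ k * ∑ r ∈ Finset.range (k + 1),
      cntZ (fun _ => True) (n - crankExp (k + 1) (r + 1)) := by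
  have h1 : ∀ r, (cnt n (Crosses (r + 1)) : ℤ) = ∑ k ∈ Finset.range K,
      (-1) ^ k * cntZ (fun _ => True) (n - crankExp (k + 1) (r + 1)) := by
    intro r
    have := le_crankExp K (r + 1) (by omega)
    rw [← cntZ_natCast, cntZ_crosses_expand _ _ K,
      cntZ_of_neg _ (show (n : ℤ) - crankExp K (r + 1) < 0 by omega)]
    ring
  have h2 : ∀ r, (cnt n (fun f => 0 < f (f 0 + r)) : ℤ) = ∑ k ∈ Finset.range K,
      (-1) ^ k * cntZ (fun _ => True) (n - crankExp (k + 1) (r + (k + 1) + 1)) := by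
    intro r
    have := le_crankExp K (r + K + 1) (by omega)
    rw [← cntZ_natCast, cntZ_rank_expand _ _ K,
      cntZ_of_neg _ (show (n : ℤ) - crankExp K (r + K + 1) < 0 by omega)]
    ring
  rw [ospt_eq n hn, Finset.sum_congr rfl (fun r _ => h1 r), Finset.sum_congr rfl (fun r _ => h2 r),
    Finset.sum_comm, Finset.sum_comm (s := Finset.range n), ← Finset.sum_sub_distrib]
  refine Finset.sum_congr rfl fun k _ => ?_
  rw [← Finset.mul_sum, ← Finset.mul_sum, ← mul_sub]
  congr 1
  have h3 := Finset.sum_range_add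
    (fun r => cntZ (fun _ => True) (n - crankExp (k + 1) (r + 1))) n (k + 1)
  have h4 := Finset.sum_range_add
    (fun r => cntZ (fun _ => True) (n - crankExp (k + 1) (r + 1))) (k + 1) n
  have h5 : ∑ r ∈ Finset.range (k + 1),
      cntZ (fun _ => True) (n - crankExp (k + 1) (n + r + 1)) = 0 :=
    Finset.sum_eq_zero fun r _ => cntZ_of_neg _ (by
      have := le_crankExp_succ k (n + r + 1)
      omega)
  rw [h5, add_comm n, h4] at h3
  simp only [add_comm (k + 1)] at h3
  linarith

theorem cntZ_sub_cntZ (P : (ℕ → ℕ) → Prop) {c : ℕ} (hc : 1 ≤ c)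
    (hP : ∀ f : ℕ → ℕ, P f ↔ P (bump c f)) (z : ℤ) :
    cntZ P z - cntZ P (z - c) = cntZ (fun f => P f ∧ ¬ f c < f (c - 1)) z := by
  rcases lt_or_ge z 0 with h0 | h0
  · rw [cntZ_of_neg _ h0, cntZ_of_neg _ h0, cntZ_of_neg _ (by omega), sub_zero]
  lift z to ℕ using h0
  rcases lt_or_ge (z : ℤ) c with h | h
  · rw [cntZ_of_neg _ (sub_neg.2 h), sub_zero, cntZ_natCast, cntZ_natCast, Nat.cast_inj]
    refine cnt_congr fun f hf => (and_iff_left fun hlt => ?_).symm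
    have := hf.le_of_lt_apply hc hlt
    omega
  · obtain ⟨n, rfl⟩ : ∃ n : ℕ, z = n + c := ⟨z - c, by omega⟩
    have e : ((n + c : ℕ) : ℤ) - c = n := by omega
    have h1 := cnt_bump (n := n) hc (fun f _ => hP f)
    have h2 := cnt_and_add_cnt_and_not (n + c) P (fun f => f c < f (c - 1))
    rw [e, cntZ_natCast, cntZ_natCast, cntZ_natCast]
    omega

theorem cntZ_second_difference {b c : ℕ} (hb : 1 ≤ b) (hc : 1 ≤ c) (hbc : b ≠ c) (z : ℤ) :
    cntZ (fun _ => True) z - cntZ (fun _ => True) (z - b) - cntZ (fun _ => True) (z - c) +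
      cntZ (fun _ => True) (z - b - c) =
      cntZ (fun f => (True ∧ ¬ f b < f (b - 1)) ∧ ¬ f c < f (c - 1)) z := by
  have h1 := cntZ_sub_cntZ (fun _ => True) hb (fun _ => Iff.rfl)
  rw [← cntZ_sub_cntZ (fun f => True ∧ ¬ f b < f (b - 1)) hc, ← h1, ← h1, sub_right_comm z]
  · ring
  · intro f
    simp only [true_and]
    unfold bump
    split_ifs <;> omega

theorem cntZ_second_difference_pos {b c : ℕ} (hb : 2 ≤ b) (hc : 2 ≤ c) {z : ℤ} (hz : 0 ≤ z) :
    0 < cntZ (fun f => (True ∧ ¬ f b < f (b - 1)) ∧ ¬ f c < f (c - 1)) z := by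
  lift z to ℕ using hz
  rw [cntZ_natCast, Nat.cast_pos]
  have h0 : ∀ i, 1 ≤ i → (if i = 0 then z else 0) = 0 := fun i hi => if_neg (by omega)
  refine cnt_pos (f := fun i => if i = 0 then z else 0)
    ⟨antitone_nat_of_succ_le fun i => ?_, 1, fun L hL => ?_⟩ ?_
  · rw [h0 _ (by omega)]; exact Nat.zero_le _
  · rw [Finset.sum_ite_eq' (Finset.range L) 0, if_pos (Finset.mem_range.2 hL)]
  · dsimp only
    rw [h0 b (by omega), h0 _ (by omega), h0 c (by omega), h0 _ (by omega)]
    simp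

theorem bracket_eq (N : ℤ) {n m : ℕ} (hm : 1 ≤ m) (hmn : m ≤ n) :
    cntZ (fun _ => True) (N - crankExp n m) + cntZ (fun _ => True) (N - crankExp n (m + 1)) -
      cntZ (fun _ => True) (N - crankExp (n + 1) m) -
      cntZ (fun _ => True) (N - crankExp (n + 1) (m + 1)) =
    cntZ (fun f => (True ∧ ¬ f m < f (m - 1)) ∧ ¬ f (n + m) < f (n + m - 1))
      (N - crankExp n m) +
    cntZ (fun f => (True ∧ ¬ f (2 * m) < f (2 * m - 1)) ∧
      ¬ f (n + m + 1) < f (n + m + 1 - 1)) (N - crankExp n (m + 1)) +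
    (cntZ (fun _ => True) (N - crankExp n m - m) -
      cntZ (fun _ => True) (N - crankExp (n + 2) m - m)) := by
  rw [← cntZ_second_difference hm (by omega) (by omega),
    ← cntZ_second_difference (by omega) (by omega) (by omega)]
  have e1 : crankExp (n + 1) m = crankExp n m + n + m := rfl
  have e2 : crankExp (n + 2) m = crankExp n m + n + m + (n + 1) + m := rfl
  rw [crankExp_succ_right (n + 1), crankExp_succ_right n, e1, e2]
  set z := N - crankExp n m with hz
  have a1 : N - (crankExp n m + n : ℕ) = z - n := by push_cast; omega
  have a2 : N - (crankExp n m + n + m : ℕ) = z - (n + m : ℕ) := by push_cast; omega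
  have a3 : N - (crankExp n m + n + m + (n + 1) : ℕ) = z - n - (n + m + 1 : ℕ) := by
    push_cast; omega
  have a4 : N - (crankExp n m + n + m + (n + 1) + m : ℕ) - m =
      z - n - (2 * m : ℕ) - (n + m + 1 : ℕ) := by push_cast; omega
  have a5 : z - m - (n + m : ℕ) = z - n - (2 * m : ℕ) := by push_cast; omega
  rw [a1, a2, a3, a4, a5]
  ring

theorem sum_range_two_mul (u : ℕ → ℤ) (n : ℕ) :
    ∑ r ∈ Finset.range (2 * n), u r = ∑ i ∈ Finset.range n, (u (2 * i) + u (2 * i + 1)) := by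
  induction n with
  | zero => simp
  | succ n ih =>
    rw [Nat.mul_succ, Finset.sum_range_succ, Finset.sum_range_succ, Finset.sum_range_succ, ih]
    ring

theorem alternating_sum_lower_bound (N : ℤ) (hN : 2 ≤ N) (L : ℕ) :
    1 - ∑ i ∈ Finset.range (L + 1),
      cntZ (fun _ => True) (N - crankExp (2 * (L + 1) + 1) (2 * i + 1) - (2 * i + 1 : ℕ)) ≤
    ∑ k ∈ Finset.range (L + 1),
      (∑ r ∈ Finset.range (2 * k + 1), cntZ (fun _ => True) (N - crankExp (2 * k + 1) (r + 1)) -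
        ∑ r ∈ Finset.range (2 * k + 1 + 1),
          cntZ (fun _ => True) (N - crankExp (2 * k + 1 + 1) (r + 1))) := by
  have hblock : ∀ k, ∑ r ∈ Finset.range (2 * k + 1),
      cntZ (fun _ => True) (N - crankExp (2 * k + 1) (r + 1)) -
        ∑ r ∈ Finset.range (2 * k + 1 + 1),
          cntZ (fun _ => True) (N - crankExp (2 * k + 1 + 1) (r + 1)) =
      ∑ i ∈ Finset.range (k + 1),
        (cntZ (fun _ => True) (N - crankExp (2 * k + 1) (2 * i + 1)) +
          cntZ (fun _ => True) (N - crankExp (2 * k + 1) (2 * i + 1 + 1)) -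
          cntZ (fun _ => True) (N - crankExp (2 * k + 1 + 1) (2 * i + 1)) -
          cntZ (fun _ => True) (N - crankExp (2 * k + 1 + 1) (2 * i + 1 + 1))) -
      cntZ (fun _ => True) (N - crankExp (2 * k + 1) (2 * k + 1) - (2 * k + 1 : ℕ)) := by
    intro k
    have h1 := Finset.sum_range_succ
      (fun r => cntZ (fun _ => True) (N - crankExp (2 * k + 1) (r + 1))) (2 * k + 1)
    have h2 := sum_range_two_mul
      (fun r => cntZ (fun _ => True) (N - crankExp (2 * k + 1) (r + 1))) (k + 1)
    have h3 := sum_range_two_mul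
      (fun r => cntZ (fun _ => True) (N - crankExp (2 * k + 1 + 1) (r + 1))) (k + 1)
    have e : N - crankExp (2 * k + 1) (2 * k + 1) - (2 * k + 1 : ℕ) =
        N - crankExp (2 * k + 1) (2 * k + 1 + 1) := by
      rw [crankExp_succ_right (2 * k + 1) (2 * k + 1)]; push_cast; ring
    rw [show 2 * (k + 1) = 2 * k + 1 + 1 by ring] at h2 h3
    rw [h3, e]
    simp only [Finset.sum_sub_distrib, Finset.sum_add_distrib] at h2 ⊢
    linarith
  have hge : ∀ k i, i < k + 1 →
      cntZ (fun _ => True) (N - crankExp (2 * k + 1) (2 * i + 1) - (2 * i + 1 : ℕ)) -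
      cntZ (fun _ => True) (N - crankExp (2 * (k + 1) + 1) (2 * i + 1) - (2 * i + 1 : ℕ)) ≤
      cntZ (fun _ => True) (N - crankExp (2 * k + 1) (2 * i + 1)) +
          cntZ (fun _ => True) (N - crankExp (2 * k + 1) (2 * i + 1 + 1)) -
          cntZ (fun _ => True) (N - crankExp (2 * k + 1 + 1) (2 * i + 1)) -
          cntZ (fun _ => True) (N - crankExp (2 * k + 1 + 1) (2 * i + 1 + 1)) := by
    intro k i hi
    rw [bracket_eq N (by omega) (by omega)]
    exact le_add_of_nonneg_left (add_nonneg (cntZ_nonneg _ _) (cntZ_nonneg _ _))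
  induction L with
  | zero =>
    rw [Finset.sum_range_one, Finset.sum_range_one, hblock, Finset.sum_range_one,
      bracket_eq N (by omega) (by omega)]
    have h1 := cntZ_nonneg (fun f => (True ∧ ¬ f 1 < f (1 - 1)) ∧ ¬ f (1 + 1) < f (1 + 1 - 1))
      (N - crankExp 1 1)
    have h2 := cntZ_second_difference_pos (b := 2 * 1) (c := 1 + 1 + 1) (by omega) (by omega)
      (z := N - crankExp 1 (1 + 1)) (by simp only [crankExp]; omega)
    simp only [mul_zero, zero_add, mul_one] at h1 h2 ⊢
    linarith
  | succ L ih =>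
    conv_rhs => rw [Finset.sum_range_succ, hblock (L + 1)]
    have h1 := Finset.sum_le_sum (fun i hi => hge (L + 1) i (Finset.mem_range.1 hi))
    rw [Finset.sum_sub_distrib, Finset.sum_range_succ _ (L + 1)] at h1
    linarith
end RankCrank

open RankCrank in
/-- For every `n > 1`, `ospt n > 0`. -/
theorem ospt_pos (n : ℕ) (hn : 1 < n) : 0 < ospt n := by
  have h1 := alternating_sum_lower_bound n (by omega) n
  have h2 : ∑ i ∈ Finset.range (n + 1),
      cntZ (fun _ => True) (n - crankExp (2 * (n + 1) + 1) (2 * i + 1) - (2 * i + 1 : ℕ)) = 0 :=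
    Finset.sum_eq_zero fun i _ => cntZ_of_neg _ (by
      have := le_crankExp (2 * (n + 1) + 1) (2 * i + 1) (by omega)
      omega)
  rw [ospt_eq_sum n hn (2 * (n + 1)) (by omega), sum_range_two_mul]
  have h3 : ∀ k : ℕ, (-1 : ℤ) ^ (2 * k) = 1 := fun k => by rw [pow_mul]; simp
  simp only [pow_succ, h3, one_mul, mul_neg, neg_mul, mul_one, ← sub_eq_add_neg]
  omega
end
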